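/- Let X be a finite set, M ≥ 0, and f : 2^X → [0,M] invariant under a group 𝒢 of permutations of X. Let F be the multilinear extension of f, x̄ = (1/|𝒢|) ∑_{σ∈𝒢} σ(x), G(x) = F(x̄), H(x) = F(x) − G(x), and D(x) = ‖x − x̄‖². Let α > 0 and let φ : [0,∞) → [0,1] be continuously differentiable, twice differentiable outside a finite set, with |t φ′(t)| ≤ 4α for all t and |t² φ″(t)| ≤ 10α wherever φ″ exists. Define F̃(x) = (1 − φ(D(x))) F(x) + φ(D(x)) G(x). Suppose ∂²F/∂x_i∂x_j(x) ≤ 0 for all i, j ∈ X and all x ∈ [0,1]^X. Then at every x ∈ [0,1]^X at which φ is twice differentiable at D(x), ∂²F̃/∂x_i∂x_j(x) ≤ 512 M |X| α for all i, j. If in addition ∂F/∂x_i(x) ≥ 0 for all i and all x, then at every x at which φ is differentiable at D(x), ∂F̃/∂x_i(x) ≥ −64 M |X| α for all i. -/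

import Mathlib

open scoped Classical

/-- The multilinear extension `F(x) = ∑_{S⊆X} f(S) ∏_{i∈S} x_i ∏_{j∉S} (1 - x_j)`. -/
noncomputable def mExt {X : Type*} [Fintype X] [DecidableEq X]
    (f : Set X → ℝ) (x : X → ℝ) : ℝ :=
  ∑ S : Finset X, f ↑S * ((∏ i ∈ S, x i) * ∏ j ∈ Sᶜ, (1 - x j))

/-- The symmetrization `x̄ = (1/|𝒢|) ∑_{σ∈𝒢} σ(x)`, where `(σ(x))_i = x_{σ⁻¹(i)}`. -/
noncomputable def symmetrize {X : Type*} [Fintype X] (G : Subgroup (Equiv.Perm X))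
    (x : X → ℝ) : X → ℝ :=
  fun i => (∑ σ : G, x ((σ : Equiv.Perm X)⁻¹ i)) / (Fintype.card G)

/-- `D(x) = ‖x - x̄‖² = ∑_i (x_i - x̄_i)²`. -/
noncomputable def symD {X : Type*} [Fintype X] (G : Subgroup (Equiv.Perm X))
    (x : X → ℝ) : ℝ :=
  ∑ i, (x i - symmetrize G x i) ^ 2

/-- The perturbed function `F̃(x) = (1 - φ(D(x))) F(x) + φ(D(x)) G(x)`,
where `G(x) = F(x̄)`. -/
noncomputable def pert {X : Type*} [Fintype X] [DecidableEq X]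
    (G : Subgroup (Equiv.Perm X)) (f : Set X → ℝ) (φ : ℝ → ℝ) (x : X → ℝ) : ℝ :=
  (1 - φ (symD G x)) * mExt f x + φ (symD G x) * mExt f (symmetrize G x)

section MultiAffine

variable {X : Type*} [DecidableEq X]

/-- A real function on `X → ℝ` that is affine in each coordinate separately. -/
def IsMultiAffine (g : (X → ℝ) → ℝ) : Prop :=
  ∀ x i t, g (Function.update x i t) = g (Function.update x i 0) +
    t * (g (Function.update x i 1) - g (Function.update x i 0))

/-- The difference of `g` between the upper and the lower face in direction `i`. -/
def faceDiff (g : (X → ℝ) → ℝ) (i : X) (x : X → ℝ) : ℝ :=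
  g (Function.update x i 1) - g (Function.update x i 0)

theorem IsMultiAffine.faceDiff {g : (X → ℝ) → ℝ} (hg : IsMultiAffine g) (i : X) :
    IsMultiAffine (faceDiff g i) := by
  intro x j t
  by_cases h : j = i
  · subst h
    simp [_root_.faceDiff]
  · simp only [_root_.faceDiff, Function.update_comm h]
    have h1 := hg (Function.update x i 1) j t
    have h0 := hg (Function.update x i 0) j t
    linear_combination h1 - h0

theorem IsMultiAffine.fderiv_single [Fintype X] {g : (X → ℝ) → ℝ} (hg : IsMultiAffine g)
    (hd : Differentiable ℝ g) (x : X → ℝ) (i : X) :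
    fderiv ℝ g x (Pi.single i 1) = _root_.faceDiff g i x := by
  have h1 : HasDerivAt (g ∘ Function.update x i) (fderiv ℝ g x (Pi.single i 1)) (x i) := by
    apply HasFDerivAt.comp_hasDerivAt (x i) _ (hasDerivAt_update x i (x i))
    rw [Function.update_eq_self]
    exact (hd x).hasFDerivAt
  have h2 : HasDerivAt (g ∘ Function.update x i) (_root_.faceDiff g i x) (x i) := by
    have : g ∘ Function.update x i = fun t => g (Function.update x i 0) +
        t * _root_.faceDiff g i x := funext fun t => hg x i t
    rw [this]
    simpa using ((hasDerivAt_id (x i)).mul_const (_root_.faceDiff g i x)).const_add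
      (g (Function.update x i 0))
  exact h1.unique h2

theorem update_mem_unitCube {x : X → ℝ} (hx : x ∈ Set.Icc (0 : X → ℝ) 1) (i : X) {t : ℝ}
    (ht : t ∈ Set.Icc (0 : ℝ) 1) : Function.update x i t ∈ Set.Icc (0 : X → ℝ) 1 := by
  rw [← Set.pi_univ_Icc] at hx ⊢
  intro k _
  by_cases h : k = i
  · subst h
    simpa using ht
  · simpa [Function.update_of_ne h] using hx k trivial

theorem abs_faceDiff_le {g : (X → ℝ) → ℝ} {a b : ℝ}
    (hg : ∀ x ∈ Set.Icc (0 : X → ℝ) 1, g x ∈ Set.Icc a b) (i : X) {x : X → ℝ}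
    (hx : x ∈ Set.Icc (0 : X → ℝ) 1) : |faceDiff g i x| ≤ b - a := by
  have h1 := hg _ (update_mem_unitCube hx i (t := 1) (by simp))
  have h0 := hg _ (update_mem_unitCube hx i (t := 0) (by simp))
  rw [faceDiff, abs_le]
  constructor <;> linarith [h1.1, h1.2, h0.1, h0.2]

theorem continuousLinearMap_apply_eq_sum [Fintype X] (L : (X → ℝ) →L[ℝ] ℝ) (v : X → ℝ) :
    L v = ∑ i, v i * L (Pi.single i 1) := by
  conv_lhs => rw [pi_eq_sum_univ' v]
  simp

theorem abs_sub_le_mul_sum_abs [Fintype X] {g : (X → ℝ) → ℝ} (hd : Differentiable ℝ g) {C : ℝ}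
    (hC : ∀ x ∈ Set.Icc (0 : X → ℝ) 1, ∀ i, |fderiv ℝ g x (Pi.single i 1)| ≤ C)
    {x y : X → ℝ} (hx : x ∈ Set.Icc (0 : X → ℝ) 1) (hy : y ∈ Set.Icc (0 : X → ℝ) 1) :
    |g x - g y| ≤ C * ∑ i, |x i - y i| := by
  have hconv : Convex ℝ (Set.Icc (0 : X → ℝ) 1) := convex_Icc _ _
  obtain ⟨z, hz, h⟩ := domain_mvt (f := g)
    (fun w _ => (hd w).hasFDerivAt.hasFDerivWithinAt) hconv hy hx
  rw [h, continuousLinearMap_apply_eq_sum, Finset.mul_sum]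
  refine (Finset.abs_sum_le_sum_abs _ _).trans (Finset.sum_le_sum fun i _ => ?_)
  rw [abs_mul, mul_comm]
  exact mul_le_mul_of_nonneg_right (hC z (hconv.segment_subset hy hx hz) i) (abs_nonneg _)

end MultiAffine

section MultilinearExtension

variable {X : Type*} [Fintype X] [DecidableEq X]

theorem contDiff_mExt (f : Set X → ℝ) {n : WithTop ℕ∞} : ContDiff ℝ n (mExt f) := by
  unfold mExt
  refine ContDiff.sum fun S _ => contDiff_const.mul (ContDiff.mul ?_ ?_) <;>
    refine contDiff_prod fun i _ => ?_ <;> fun_prop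

theorem isMultiAffine_mExt (f : Set X → ℝ) : IsMultiAffine (mExt f) := by
  intro x i t
  have key : ∀ (S : Finset X) (t : ℝ),
      (∏ k ∈ S, Function.update x i t k) * ∏ k ∈ Sᶜ, (1 - Function.update x i t k) =
      if i ∈ S then t * ((∏ k ∈ S \ {i}, x k) * ∏ k ∈ Sᶜ, (1 - x k))
      else (1 - t) * ((∏ k ∈ S, x k) * ∏ k ∈ Sᶜ \ {i}, (1 - x k)) := by
    intro S t
    have h : ∀ k, 1 - Function.update x i t k =
        Function.update (fun k => 1 - x k) i (1 - t) k := by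
      intro k
      by_cases hk : k = i
      · subst hk; simp
      · simp [Function.update_of_ne hk]
    simp only [h]
    split_ifs with hi
    · rw [Finset.prod_update_of_mem hi, Finset.prod_update_of_notMem (by simpa using hi)]
      ring
    · rw [Finset.prod_update_of_notMem hi, Finset.prod_update_of_mem (by simpa using hi)]
      ring
  simp only [mExt, key]
  rw [← Finset.sum_sub_distrib, Finset.mul_sum, ← Finset.sum_add_distrib]
  refine Finset.sum_congr rfl fun S _ => ?_
  split_ifs <;> ring

theorem mExt_mem_Icc {f : Set X → ℝ} {M : ℝ} (hf : ∀ S, f S ∈ Set.Icc 0 M)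
    {x : X → ℝ} (hx : x ∈ Set.Icc (0 : X → ℝ) 1) : mExt f x ∈ Set.Icc 0 M := by
  have hw : ∀ S : Finset X, 0 ≤ (∏ i ∈ S, x i) * ∏ j ∈ Sᶜ, (1 - x j) := fun S =>
    mul_nonneg (Finset.prod_nonneg fun i _ => hx.1 i)
      (Finset.prod_nonneg fun i _ => sub_nonneg.2 (hx.2 i))
  have hsum : ∑ S : Finset X, (∏ i ∈ S, x i) * ∏ j ∈ Sᶜ, (1 - x j) = 1 := by
    rw [← Fintype.prod_add]
    simp
  refine ⟨Finset.sum_nonneg fun S _ => mul_nonneg (hf _).1 (hw S), ?_⟩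
  calc mExt f x ≤ ∑ S : Finset X, M * ((∏ i ∈ S, x i) * ∏ j ∈ Sᶜ, (1 - x j)) :=
        Finset.sum_le_sum fun S _ => mul_le_mul_of_nonneg_right (hf _).2 (hw S)
    _ = M := by rw [← Finset.mul_sum, hsum, mul_one]

theorem mExt_comp_perm {f : Set X → ℝ} {σ : Equiv.Perm X} (hσ : ∀ S : Set X, f (σ '' S) = f S)
    (x : X → ℝ) : mExt f (fun i => x (σ⁻¹ i)) = mExt f x := by
  unfold mExt
  refine (Fintype.sum_equiv σ.finsetCongr _ _ fun S => ?_).symm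
  have hc : (S.map σ.toEmbedding)ᶜ = Sᶜ.map σ.toEmbedding := by
    ext k
    simp [Finset.mem_map_equiv]
  simp only [Equiv.finsetCongr_apply, hc, Finset.prod_map, Finset.coe_map,
    Equiv.coe_toEmbedding, hσ, Equiv.Perm.inv_def, Equiv.symm_apply_apply]

theorem fderiv_mExt_single (f : Set X → ℝ) (i : X) (x : X → ℝ) :
    fderiv ℝ (mExt f) x (Pi.single i 1) = faceDiff (mExt f) i x :=
  (isMultiAffine_mExt f).fderiv_single ((contDiff_mExt f (n := 1)).differentiable one_ne_zero) x i

theorem differentiable_fderiv_mExt_apply (f : Set X → ℝ) (v : X → ℝ) :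
    Differentiable ℝ fun y => fderiv ℝ (mExt f) y v :=
  (((contDiff_mExt f (n := 2)).fderiv_right (m := 1) (by norm_num)).differentiable
    one_ne_zero).clm_apply (differentiable_const v)

theorem abs_fderiv_fderiv_mExt_le {f : Set X → ℝ} {M : ℝ} (hf : ∀ S, f S ∈ Set.Icc 0 M)
    {x : X → ℝ} (hx : x ∈ Set.Icc (0 : X → ℝ) 1) (i j : X) :
    |fderiv ℝ (fun y => fderiv ℝ (mExt f) y (Pi.single i 1)) x (Pi.single j 1)| ≤ 2 * M := by
  have hd := differentiable_fderiv_mExt_apply f (Pi.single i 1)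
  simp only [fderiv_mExt_single] at hd ⊢
  rw [((isMultiAffine_mExt f).faceDiff i).fderiv_single hd]
  refine (abs_faceDiff_le (a := -M) (b := M) (fun y hy => ?_) j hx).trans_eq (by ring)
  have := abs_faceDiff_le (fun _ => mExt_mem_Icc hf) i hy
  exact abs_le.1 (by simpa using this)

end MultilinearExtension

section Symmetrization

variable {X : Type*} [Fintype X] (G : Subgroup (Equiv.Perm X))

/-- Symmetrization as a continuous linear map. -/
noncomputable def symmetrizeCLM : (X → ℝ) →L[ℝ] (X → ℝ) :=
  LinearMap.toContinuousLinearMap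
    { toFun := symmetrize G
      map_add' := fun x y => by
        ext i
        simp [symmetrize, Finset.sum_add_distrib, add_div]
      map_smul' := fun c x => by
        ext i
        simp [symmetrize, ← Finset.mul_sum, mul_div_assoc] }

@[simp]
theorem symmetrizeCLM_apply (x : X → ℝ) : symmetrizeCLM G x = symmetrize G x := rfl

/-- The asymmetric part `x - x̄` of `x`, as a continuous linear map. -/
noncomputable def asymCLM : (X → ℝ) →L[ℝ] (X → ℝ) :=
  ContinuousLinearMap.id ℝ (X → ℝ) - symmetrizeCLM G

theorem asymCLM_apply (x : X → ℝ) (i : X) : asymCLM G x i = x i - symmetrize G x i := rfl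

theorem symD_eq_sum_asymCLM (x : X → ℝ) : symD G x = ∑ i, asymCLM G x i ^ 2 := rfl

theorem card_subgroup_pos : (0 : ℝ) < Fintype.card G := by
  exact_mod_cast Fintype.card_pos

variable {G} in
theorem symmetrize_apply_inv {τ : Equiv.Perm X} (hτ : τ ∈ G) (x : X → ℝ) (i : X) :
    symmetrize G x (τ⁻¹ i) = symmetrize G x i := by
  unfold symmetrize
  congr 1
  refine Fintype.sum_equiv (Equiv.mulLeft (⟨τ, hτ⟩ : G)) _ _ fun σ => ?_
  simp [mul_inv_rev]

theorem symmetrize_nonneg {x : X → ℝ} (hx : 0 ≤ x) : 0 ≤ symmetrize G x := fun _ =>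
  div_nonneg (Finset.sum_nonneg fun _ _ => hx _) (card_subgroup_pos G).le

theorem symmetrize_mem_unitCube {x : X → ℝ} (hx : x ∈ Set.Icc (0 : X → ℝ) 1) :
    symmetrize G x ∈ Set.Icc (0 : X → ℝ) 1 := by
  refine ⟨symmetrize_nonneg G hx.1, fun i => ?_⟩
  rw [symmetrize, Pi.one_apply, div_le_one (card_subgroup_pos G)]
  refine (Finset.sum_le_sum fun (σ : G) _ => hx.2 ((σ : Equiv.Perm X)⁻¹ i)).trans ?_
  simp

theorem sum_symmetrize (x : X → ℝ) : ∑ i, symmetrize G x i = ∑ i, x i := by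
  have h : ∀ σ : G, ∑ i, x ((σ : Equiv.Perm X)⁻¹ i) = ∑ i, x i := fun σ =>
    Equiv.sum_comp _ x
  simp only [symmetrize]
  rw [← Finset.sum_div, Finset.sum_comm]
  simp only [h, Finset.sum_const, Finset.card_univ, nsmul_eq_mul]
  exact mul_div_cancel_left₀ _ (card_subgroup_pos G).ne'

variable {G} in
theorem map_symmetrize_of_invariant (L : (X → ℝ) →L[ℝ] ℝ) {v : X → ℝ}
    (hL : ∀ σ ∈ G, L (fun i => v (σ⁻¹ i)) = L v) : L (symmetrize G v) = L v := by
  have hv : symmetrize G v =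
      (Fintype.card G : ℝ)⁻¹ • ∑ σ : G, fun i => v ((σ : Equiv.Perm X)⁻¹ i) := by
    ext i
    simp [symmetrize, div_eq_inv_mul]
  rw [hv, map_smul, map_sum, Finset.sum_congr rfl fun (σ : G) _ => hL σ σ.2]
  simp only [Finset.sum_const, Finset.card_univ, nsmul_eq_mul, smul_eq_mul]
  exact inv_mul_cancel_left₀ (card_subgroup_pos G).ne' _

theorem sum_abs_asymCLM_single_le [DecidableEq X] (i : X) :
    ∑ k, |asymCLM G (Pi.single i 1) k| ≤ 2 := by
  have h0 : (0 : X → ℝ) ≤ Pi.single i 1 := Pi.single_nonneg.2 zero_le_one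
  have h1 : ∑ k, (Pi.single i 1 : X → ℝ) k = 1 := by simp
  calc ∑ k, |asymCLM G (Pi.single i 1) k|
      ≤ ∑ k, ((Pi.single i 1 : X → ℝ) k + symmetrize G (Pi.single i 1) k) := by
        refine Finset.sum_le_sum fun k _ => ?_
        rw [asymCLM_apply, abs_le]
        have a := h0 k
        have b := symmetrize_nonneg G h0 k
        simp only [Pi.zero_apply] at a b
        constructor <;> linarith
    _ = 2 := by rw [Finset.sum_add_distrib, sum_symmetrize, h1]; norm_num

theorem abs_asymCLM_apply_le_one {x : X → ℝ} (hx : x ∈ Set.Icc (0 : X → ℝ) 1) (i : X) :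
    |asymCLM G x i| ≤ 1 := by
  have h := symmetrize_mem_unitCube G hx
  have a := hx.1 i
  have b := hx.2 i
  have c := h.1 i
  have d := h.2 i
  simp only [Pi.zero_apply, Pi.one_apply] at a b c d
  rw [asymCLM_apply, abs_le]
  constructor <;> linarith

theorem abs_asymCLM_apply_le_sqrt (x : X → ℝ) (i : X) : |asymCLM G x i| ≤ √(symD G x) :=
  Real.abs_le_sqrt (Finset.single_le_sum (f := fun i => asymCLM G x i ^ 2)
    (fun _ _ => sq_nonneg _) (Finset.mem_univ i))

theorem symD_nonneg (x : X → ℝ) : 0 ≤ symD G x := Finset.sum_nonneg fun _ _ => sq_nonneg _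

theorem sq_sum_abs_asymCLM_le (x : X → ℝ) :
    (∑ i, |asymCLM G x i|) ^ 2 ≤ Fintype.card X * symD G x := by
  refine sq_sum_le_card_mul_sum_sq.trans_eq ?_
  simp [symD_eq_sum_asymCLM]

/-- The symmetric form `v ↦ ⟨x - x̄, v - v̄⟩`; half the derivative of `D` at `x`. -/
noncomputable def asymForm (x : X → ℝ) : (X → ℝ) →L[ℝ] ℝ :=
  ∑ k, asymCLM G x k • (ContinuousLinearMap.proj k ∘L asymCLM G)

theorem asymForm_apply (x v : X → ℝ) :
    asymForm G x v = ∑ k, asymCLM G x k * asymCLM G v k := by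
  simp [asymForm]

theorem asymForm_comm (x v : X → ℝ) : asymForm G x v = asymForm G v x := by
  simp only [asymForm_apply, mul_comm]

theorem abs_asymForm_single_le [DecidableEq X] {x : X → ℝ} {c : ℝ}
    (hx : ∀ k, |asymCLM G x k| ≤ c) (i : X) : |asymForm G x (Pi.single i 1)| ≤ 2 * c := by
  rw [asymForm_apply]
  calc |∑ k, asymCLM G x k * asymCLM G (Pi.single i 1) k|
      ≤ ∑ k, c * |asymCLM G (Pi.single i 1) k| := by
        refine (Finset.abs_sum_le_sum_abs _ _).trans (Finset.sum_le_sum fun k _ => ?_)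
        rw [abs_mul]
        exact mul_le_mul_of_nonneg_right (hx k) (abs_nonneg _)
    _ ≤ c * 2 := by
        rw [← Finset.mul_sum]
        exact mul_le_mul_of_nonneg_left (sum_abs_asymCLM_single_le G i)
          ((abs_nonneg _).trans (hx i))
    _ = 2 * c := mul_comm _ _

theorem hasFDerivAt_symD (x : X → ℝ) : HasFDerivAt (symD G) ((2 : ℝ) • asymForm G x) x := by
  have h : ∀ k ∈ Finset.univ, HasFDerivAt (fun y => asymCLM G y k ^ 2)
      ((2 : ℝ) • asymCLM G x k • (ContinuousLinearMap.proj k ∘L asymCLM G)) x := by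
    intro k _
    have := ((ContinuousLinearMap.proj (R := ℝ) (φ := fun _ : X => ℝ) k ∘L
      asymCLM G).hasFDerivAt (x := x)).pow 2
    simpa [smul_smul] using this
  have := HasFDerivAt.fun_sum h
  rw [← Finset.smul_sum] at this
  exact this

theorem hasFDerivAt_asymForm_apply (v x : X → ℝ) :
    HasFDerivAt (fun y => asymForm G y v) (asymForm G v) x := by
  simp only [fun y => asymForm_comm G y v]
  exact (asymForm G v).hasFDerivAt

variable {G} in
theorem hasFDerivAt_comp_symD {g : ℝ → ℝ} {g' : ℝ} {x : X → ℝ}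
    (hg : HasDerivWithinAt g g' (Set.Ici 0) (symD G x)) :
    HasFDerivAt (fun y => g (symD G y)) (g' • (2 : ℝ) • asymForm G x) x :=
  hg.comp_hasFDerivAt x (hasFDerivAt_symD G x)
    (Filter.Eventually.of_forall fun y => symD_nonneg G y)

end Symmetrization

section SymmetrizedExtension

variable {X : Type*} [Fintype X] [DecidableEq X] {G : Subgroup (Equiv.Perm X)} {f : Set X → ℝ}

theorem hasFDerivAt_mExt (f : Set X → ℝ) (x : X → ℝ) :
    HasFDerivAt (mExt f) (fderiv ℝ (mExt f) x) x :=
  ((contDiff_mExt f (n := 1)).differentiable one_ne_zero x).hasFDerivAt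

theorem fderiv_mExt_symmetrize_comp_perm
    (hinv : ∀ σ ∈ G, ∀ S : Set X, f ((σ : Equiv.Perm X) '' S) = f S)
    {τ : Equiv.Perm X} (hτ : τ ∈ G) (x v : X → ℝ) :
    fderiv ℝ (mExt f) (symmetrize G x) (fun i => v (τ⁻¹ i)) =
      fderiv ℝ (mExt f) (symmetrize G x) v := by
  let P : (X → ℝ) →L[ℝ] (X → ℝ) :=
    ContinuousLinearMap.pi fun i => ContinuousLinearMap.proj (τ⁻¹ i)
  have hP : P (symmetrize G x) = symmetrize G x := funext fun i => symmetrize_apply_inv hτ x i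
  have h1 : HasFDerivAt (mExt f ∘ P) (fderiv ℝ (mExt f) (symmetrize G x) ∘L P)
      (symmetrize G x) := by
    refine HasFDerivAt.comp _ ?_ P.hasFDerivAt
    rw [hP]
    exact hasFDerivAt_mExt f _
  have h2 : mExt f ∘ P = mExt f := funext fun y => mExt_comp_perm (hinv τ hτ) y
  rw [h2] at h1
  exact DFunLike.congr_fun (h1.unique (hasFDerivAt_mExt f _)) v

theorem fderiv_mExt_symmetrize_apply_symmetrize
    (hinv : ∀ σ ∈ G, ∀ S : Set X, f ((σ : Equiv.Perm X) '' S) = f S) (x v : X → ℝ) :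
    fderiv ℝ (mExt f) (symmetrize G x) (symmetrize G v) =
      fderiv ℝ (mExt f) (symmetrize G x) v :=
  map_symmetrize_of_invariant _ fun _ hσ => fderiv_mExt_symmetrize_comp_perm hinv hσ x v

theorem hasFDerivAt_mExt_comp_symmetrize
    (hinv : ∀ σ ∈ G, ∀ S : Set X, f ((σ : Equiv.Perm X) '' S) = f S) (x : X → ℝ) :
    HasFDerivAt (fun y => mExt f (symmetrize G y)) (fderiv ℝ (mExt f) (symmetrize G x)) x := by
  have h : fderiv ℝ (mExt f) (symmetrize G x) =
      fderiv ℝ (mExt f) (symmetrize G x) ∘L symmetrizeCLM G := by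
    ext1 v
    exact (fderiv_mExt_symmetrize_apply_symmetrize hinv x v).symm
  rw [h]
  exact (hasFDerivAt_mExt f (symmetrizeCLM G x)).comp x (symmetrizeCLM G).hasFDerivAt

theorem abs_fderiv_mExt_sub_le {M : ℝ} (hf : ∀ S, f S ∈ Set.Icc 0 M) {x y : X → ℝ}
    (hx : x ∈ Set.Icc (0 : X → ℝ) 1) (hy : y ∈ Set.Icc (0 : X → ℝ) 1) (i : X) :
    |fderiv ℝ (mExt f) x (Pi.single i 1) - fderiv ℝ (mExt f) y (Pi.single i 1)| ≤
      2 * M * ∑ k, |x k - y k| :=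
  abs_sub_le_mul_sum_abs (differentiable_fderiv_mExt_apply f _)
    (fun _ hz j => abs_fderiv_fderiv_mExt_le hf hz i j) hx hy

theorem abs_mExt_sub_mExt_symmetrize_le
    (hinv : ∀ σ ∈ G, ∀ S : Set X, f ((σ : Equiv.Perm X) '' S) = f S) {M : ℝ} (hM : 0 ≤ M)
    (hf : ∀ S, f S ∈ Set.Icc 0 M) {x : X → ℝ} (hx : x ∈ Set.Icc (0 : X → ℝ) 1) :
    |mExt f x - mExt f (symmetrize G x)| ≤ 2 * M * (∑ k, |asymCLM G x k|) ^ 2 := by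
  have hs := symmetrize_mem_unitCube G hx
  have hconv : Convex ℝ (Set.Icc (0 : X → ℝ) 1) := convex_Icc _ _
  obtain ⟨z, hz, h⟩ := domain_mvt (f := mExt f)
    (fun w _ => (hasFDerivAt_mExt f w).hasFDerivWithinAt) hconv hs hx
  have hzc := hconv.segment_subset hs hx hz
  have hzero : fderiv ℝ (mExt f) (symmetrize G x) (x - symmetrize G x) = 0 := by
    rw [map_sub, fderiv_mExt_symmetrize_apply_symmetrize hinv, sub_self]
  have hdist : ∀ k, |z k - symmetrize G x k| ≤ |asymCLM G x k| := by
    intro k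
    obtain ⟨t, ht, rfl⟩ := (segment_eq_image' ℝ (symmetrize G x) x).subset hz
    simp only [Pi.add_apply, Pi.smul_apply, Pi.sub_apply, smul_eq_mul, add_sub_cancel_left,
      abs_mul, abs_of_nonneg ht.1]
    exact mul_le_of_le_one_left (abs_nonneg _) ht.2
  rw [h, ← sub_zero (fderiv ℝ (mExt f) z _), ← hzero, ← _root_.sub_apply,
    continuousLinearMap_apply_eq_sum]
  calc |∑ i, (x - symmetrize G x) i *
        (fderiv ℝ (mExt f) z - fderiv ℝ (mExt f) (symmetrize G x)) (Pi.single i 1)|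
      ≤ ∑ i, |asymCLM G x i| * (2 * M * ∑ k, |asymCLM G x k|) := by
        refine (Finset.abs_sum_le_sum_abs _ _).trans (Finset.sum_le_sum fun i _ => ?_)
        rw [abs_mul]
        refine mul_le_mul_of_nonneg_left ?_ (abs_nonneg _)
        refine (abs_fderiv_mExt_sub_le hf hzc hs i).trans ?_
        exact mul_le_mul_of_nonneg_left (Finset.sum_le_sum fun k _ => hdist k) (by positivity)
    _ = 2 * M * (∑ k, |asymCLM G x k|) ^ 2 := by rw [← Finset.sum_mul]; ring

end SymmetrizedExtension

theorem derivWithin_Ici_eq_deriv {φ : ℝ → ℝ} (hφ : ContDiffOn ℝ 1 φ (Set.Ici 0)) {t : ℝ}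
    (ht : 0 ≤ t) (hd : ContinuousAt (deriv φ) t) :
    derivWithin φ (Set.Ici 0) t = deriv φ t := by
  rcases ht.eq_or_lt with rfl | ht
  · have h1 : Filter.Tendsto (derivWithin φ (Set.Ici 0)) (nhdsWithin 0 (Set.Ioi 0))
        (nhds (derivWithin φ (Set.Ici 0) 0)) :=
      (hφ.continuousOn_derivWithin (uniqueDiffOn_Ici 0) le_rfl 0 Set.self_mem_Ici).mono
        Set.Ioi_subset_Ici_self
    have h2 : Filter.Tendsto (derivWithin φ (Set.Ici 0)) (nhdsWithin 0 (Set.Ioi 0))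
        (nhds (deriv φ 0)) := by
      refine (hd.tendsto.mono_left nhdsWithin_le_nhds).congr' ?_
      filter_upwards [self_mem_nhdsWithin] with s hs
      exact (derivWithin_of_mem_nhds (Ici_mem_nhds hs)).symm
    exact tendsto_nhds_unique h1 h2
  · exact derivWithin_of_mem_nhds (Ici_mem_nhds ht)

theorem hasDerivWithinAt_derivWithin_Ici {φ : ℝ → ℝ} (hφ : ContDiffOn ℝ 1 φ (Set.Ici 0)) {t : ℝ}
    (ht : 0 ≤ t) (hd : DifferentiableAt ℝ (deriv φ) t) :
    HasDerivWithinAt (derivWithin φ (Set.Ici 0)) (deriv (deriv φ) t) (Set.Ici 0) t := by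
  refine hd.hasDerivAt.hasDerivWithinAt.congr_of_eventuallyEq ?_
    (derivWithin_Ici_eq_deriv hφ ht hd.continuousAt)
  rcases ht.eq_or_lt with rfl | ht
  · filter_upwards [self_mem_nhdsWithin] with s hs
    rcases (Set.mem_Ici.1 hs).eq_or_lt with rfl | hs
    · exact derivWithin_Ici_eq_deriv hφ le_rfl hd.continuousAt
    · exact derivWithin_of_mem_nhds (Ici_mem_nhds hs)
  · filter_upwards [mem_nhdsWithin_of_mem_nhds (Ioi_mem_nhds ht)] with s hs
    exact derivWithin_of_mem_nhds (Ici_mem_nhds hs)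

theorem abs_mul_derivWithin_Ici_le {φ : ℝ → ℝ} {c : ℝ} (hc : 0 ≤ c)
    (hφ : ∀ t, 0 ≤ t → |t * deriv φ t| ≤ c) {t : ℝ} (ht : 0 ≤ t) :
    |derivWithin φ (Set.Ici 0) t| * t ≤ c := by
  rcases ht.eq_or_lt with rfl | ht
  · simpa using hc
  · rw [derivWithin_of_mem_nhds (Ici_mem_nhds ht), mul_comm]
    simpa [abs_mul, abs_of_pos ht] using hφ t ht.le

section Perturbation

variable {X : Type*} [Fintype X] [DecidableEq X] {G : Subgroup (Equiv.Perm X)} {f : Set X → ℝ}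
  {φ : ℝ → ℝ}

theorem hasFDerivAt_pert
    (hinv : ∀ σ ∈ G, ∀ S : Set X, f ((σ : Equiv.Perm X) '' S) = f S)
    (hφ : ContDiffOn ℝ 1 φ (Set.Ici 0)) (x : X → ℝ) :
    HasFDerivAt (pert G f φ)
      (fderiv ℝ (mExt f) x
        - φ (symD G x) • (fderiv ℝ (mExt f) x - fderiv ℝ (mExt f) (symmetrize G x))
        - (mExt f x - mExt f (symmetrize G x)) •
          derivWithin φ (Set.Ici 0) (symD G x) • (2 : ℝ) • asymForm G x) x := by
  have hφx : HasDerivWithinAt φ (derivWithin φ (Set.Ici 0) (symD G x)) (Set.Ici 0) (symD G x) :=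
    (hφ.differentiableOn one_ne_zero _ (symD_nonneg G x)).hasDerivWithinAt
  have hF := hasFDerivAt_mExt f x
  have h := hF.sub ((hasFDerivAt_comp_symD hφx).mul
    (hF.sub (hasFDerivAt_mExt_comp_symmetrize hinv x)))
  refine (h.congr_of_eventuallyEq (Filter.Eventually.of_forall fun y => ?_)).congr_fderiv ?_
  · simp only [pert, Pi.sub_apply, Pi.mul_apply]
    ring
  · rw [sub_sub]
    rfl

theorem fderiv_pert_apply
    (hinv : ∀ σ ∈ G, ∀ S : Set X, f ((σ : Equiv.Perm X) '' S) = f S)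
    (hφ : ContDiffOn ℝ 1 φ (Set.Ici 0)) (x v : X → ℝ) :
    fderiv ℝ (pert G f φ) x v =
      fderiv ℝ (mExt f) x v
        - φ (symD G x) * (fderiv ℝ (mExt f) x v - fderiv ℝ (mExt f) (symmetrize G x) v)
        - (mExt f x - mExt f (symmetrize G x)) *
          (derivWithin φ (Set.Ici 0) (symD G x) * (2 * asymForm G x v)) := by
  rw [(hasFDerivAt_pert hinv hφ x).fderiv]
  rfl

theorem fderiv_fderiv_pert_apply
    (hinv : ∀ σ ∈ G, ∀ S : Set X, f ((σ : Equiv.Perm X) '' S) = f S)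
    (hφ : ContDiffOn ℝ 1 φ (Set.Ici 0)) {x : X → ℝ}
    (hd : DifferentiableAt ℝ (deriv φ) (symD G x)) (v w : X → ℝ) :
    fderiv ℝ (fun y => fderiv ℝ (pert G f φ) y v) x w =
      (1 - φ (symD G x)) * fderiv ℝ (fun y => fderiv ℝ (mExt f) y v) x w
        + φ (symD G x) *
          fderiv ℝ (fun y => fderiv ℝ (mExt f) y v) (symmetrize G x) (symmetrize G w)
        - 2 * derivWithin φ (Set.Ici 0) (symD G x) *
          ((fderiv ℝ (mExt f) x v - fderiv ℝ (mExt f) (symmetrize G x) v) * asymForm G x w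
            + (fderiv ℝ (mExt f) x w - fderiv ℝ (mExt f) (symmetrize G x) w) * asymForm G x v
            + (mExt f x - mExt f (symmetrize G x)) * asymForm G v w)
        - 4 * deriv (deriv φ) (symD G x) *
          ((mExt f x - mExt f (symmetrize G x)) * (asymForm G x v * asymForm G x w)) := by
  simp only [fderiv_pert_apply hinv hφ]
  have hφx : HasDerivWithinAt φ (derivWithin φ (Set.Ici 0) (symD G x)) (Set.Ici 0) (symD G x) :=
    (hφ.differentiableOn one_ne_zero _ (symD_nonneg G x)).hasDerivWithinAt
  have ha := fun y => (differentiable_fderiv_mExt_apply f v y).hasFDerivAt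
  have haS := (ha (symmetrizeCLM G x)).comp x (symmetrizeCLM G).hasFDerivAt
  have hH := (hasFDerivAt_mExt f x).sub (hasFDerivAt_mExt_comp_symmetrize hinv x)
  have h := ((ha x).sub ((hasFDerivAt_comp_symD hφx).mul ((ha x).sub haS))).sub
    (hH.mul ((hasFDerivAt_comp_symD (hasDerivWithinAt_derivWithin_Ici hφ (symD_nonneg G x) hd)).mul
      ((hasFDerivAt_asymForm_apply G v x).const_mul 2)))
  refine (congrArg (fun L : (X → ℝ) →L[ℝ] ℝ => L w) h.fderiv).trans ?_
  simp only [_root_.sub_apply, _root_.add_apply, _root_.smul_apply, smul_eq_mul,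
    ContinuousLinearMap.comp_apply, symmetrizeCLM_apply, Pi.sub_apply, Pi.mul_apply,
    Function.comp_apply]
  ring

theorem fderiv_fderiv_mExt_apply_nonpos
    (hF2 : ∀ x ∈ Set.Icc (0 : X → ℝ) 1, ∀ i j : X,
      fderiv ℝ (fun y => fderiv ℝ (mExt f) y (Pi.single i 1)) x (Pi.single j 1) ≤ 0)
    {x : X → ℝ} (hx : x ∈ Set.Icc (0 : X → ℝ) 1) (i : X) {w : X → ℝ} (hw : 0 ≤ w) :
    fderiv ℝ (fun y => fderiv ℝ (mExt f) y (Pi.single i 1)) x w ≤ 0 := by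
  rw [continuousLinearMap_apply_eq_sum]
  exact Finset.sum_nonpos fun k _ => mul_nonpos_of_nonneg_of_nonpos (hw k) (hF2 x hx i k)

end Perturbation

theorem single_one_mem_unitCube {X : Type*} [DecidableEq X] (i : X) :
    Pi.single i 1 ∈ Set.Icc (0 : X → ℝ) 1 :=
  update_mem_unitCube (x := 0) (by simp) i (by simp)

/-- bounds on the first and second partial derivatives of the perturbed
function `F̃ = (1 - φ∘D)·F + (φ∘D)·G`. If `∂²F/∂x_i∂x_j ≤ 0` on `[0,1]^X` then
`∂²F̃/∂x_i∂x_j(x) ≤ 512 M |X| α` wherever `φ` is twice differentiable at `D(x)`;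
if moreover `∂F/∂x_i ≥ 0` on `[0,1]^X` then `∂F̃/∂x_i(x) ≥ -64 M |X| α` wherever `φ`
is differentiable at `D(x)`. -/
theorem stmt_6 {X : Type*} [Fintype X] [DecidableEq X] (G : Subgroup (Equiv.Perm X))
    (M α : ℝ) (hM : 0 ≤ M) (hα : 0 < α)
    (f : Set X → ℝ) (hfM : ∀ S : Set X, f S ∈ Set.Icc 0 M)
    (hinv : ∀ σ ∈ G, ∀ S : Set X, f ((σ : Equiv.Perm X) '' S) = f S)
    (φ : ℝ → ℝ) (E : Finset ℝ)
    (hφ01 : ∀ t : ℝ, 0 ≤ t → φ t ∈ Set.Icc (0 : ℝ) 1)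
    (hφC1 : ContDiffOn ℝ 1 φ (Set.Ici 0))
    (hφtwice : ∀ t : ℝ, 0 ≤ t → t ∉ E → DifferentiableAt ℝ (deriv φ) t)
    (hφ' : ∀ t : ℝ, 0 ≤ t → |t * deriv φ t| ≤ 4 * α)
    (hφ'' : ∀ t : ℝ, 0 ≤ t → t ∉ E → |t ^ 2 * deriv (deriv φ) t| ≤ 10 * α)
    (hF2 : ∀ x ∈ Set.Icc (0 : X → ℝ) 1, ∀ i j : X,
      fderiv ℝ (fun y => fderiv ℝ (mExt f) y (Pi.single i 1)) x (Pi.single j 1) ≤ 0) :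
    (∀ x ∈ Set.Icc (0 : X → ℝ) 1, symD G x ∉ E → ∀ i j : X,
      fderiv ℝ (fun y => fderiv ℝ (pert G f φ) y (Pi.single i 1)) x (Pi.single j 1)
        ≤ 512 * M * (Fintype.card X) * α) ∧
    ((∀ x ∈ Set.Icc (0 : X → ℝ) 1, ∀ i : X, 0 ≤ fderiv ℝ (mExt f) x (Pi.single i 1)) →
      ∀ x ∈ Set.Icc (0 : X → ℝ) 1, DifferentiableAt ℝ φ (symD G x) → ∀ i : X,
        -(64 * M * (Fintype.card X) * α) ≤ fderiv ℝ (pert G f φ) x (Pi.single i 1)) := by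
  have key : ∀ x : X → ℝ, 2 * M * (∑ k, |asymCLM G x k|) ^ 2 ≤
      2 * M * (Fintype.card X * symD G x) := fun x =>
    mul_le_mul_of_nonneg_left (sq_sum_abs_asymCLM_le G x) (by positivity)
  have hn : (0 : ℝ) ≤ Fintype.card X := Nat.cast_nonneg _
  refine ⟨fun x hx hxE i j => ?_, fun hF1 x hx _ i => ?_⟩
  · have hxs := symmetrize_mem_unitCube G hx
    have hD := symD_nonneg G x
    have hφx := hφ01 _ hD
    have hψ := abs_mul_derivWithin_Ici_le (by positivity) hφ' hD
    have hχ := hφ'' _ hD hxE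
    rw [fderiv_fderiv_pert_apply hinv hφC1 (hφtwice _ hD hxE)]
    have hconc := mul_nonpos_of_nonneg_of_nonpos (sub_nonneg.2 hφx.2) (hF2 x hx i j)
    have hconcS := mul_nonpos_of_nonneg_of_nonpos hφx.1
      (fderiv_fderiv_mExt_apply_nonpos hF2 hxs i
        (symmetrize_nonneg G (single_one_mem_unitCube j).1))
    have hgi := abs_fderiv_mExt_sub_le hfM hx hxs i
    have hgj := abs_fderiv_mExt_sub_le hfM hx hxs j
    have hH := (abs_mExt_sub_mExt_symmetrize_le hinv hM hfM hx).trans (key x)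
    have hle : ∀ k, |asymCLM G x k| ≤ ∑ k, |asymCLM G x k| := fun k =>
      Finset.single_le_sum (f := fun k => |asymCLM G x k|) (fun _ _ => abs_nonneg _)
        (Finset.mem_univ k)
    have hAi := abs_asymForm_single_le G hle i
    have hAj := abs_asymForm_single_le G hle j
    have hBi := abs_asymForm_single_le G (abs_asymCLM_apply_le_sqrt G x) i
    have hBj := abs_asymForm_single_le G (abs_asymCLM_apply_le_sqrt G x) j
    have hij := abs_asymForm_single_le G (abs_asymCLM_apply_le_one G (single_one_mem_unitCube i)) j
    have hs := key x
    have hs0 : 0 ≤ ∑ k, |asymCLM G x k| := Finset.sum_nonneg fun _ _ => abs_nonneg _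
    simp only [← asymCLM_apply] at hgi hgj
    have hr := Real.sq_sqrt hD
    have hr0 := Real.sqrt_nonneg (symD G x)
    generalize √(symD G x) = r at *
    generalize (∑ k, |asymCLM G x k|) = s at *
    generalize symD G x = D at *
    generalize (Fintype.card X : ℝ) = n at *
    generalize fderiv ℝ (mExt f) x (Pi.single i 1) -
      fderiv ℝ (mExt f) (symmetrize G x) (Pi.single i 1) = gi at *
    generalize fderiv ℝ (mExt f) x (Pi.single j 1) -
      fderiv ℝ (mExt f) (symmetrize G x) (Pi.single j 1) = gj at *
    generalize mExt f x - mExt f (symmetrize G x) = H at *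
    generalize asymForm G x (Pi.single i 1) = Ai at *
    generalize asymForm G x (Pi.single j 1) = Aj at *
    generalize asymForm G (Pi.single i 1) (Pi.single j 1) = Aij at *
    have h1 : |gi * Aj + gj * Ai + H * Aij| ≤ 12 * (M * n * D) := by
      have e1 : |gi * Aj| ≤ (2 * M * s) * (2 * s) := by
        rw [abs_mul]; gcongr
      have e2 : |gj * Ai| ≤ (2 * M * s) * (2 * s) := by
        rw [abs_mul]; gcongr
      have e3 : |H * Aij| ≤ (2 * M * (n * D)) * (2 * 1) := by
        rw [abs_mul]; gcongr
      linarith [abs_add_le (gi * Aj + gj * Ai) (H * Aij), abs_add_le (gi * Aj) (gj * Ai)]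
    have h2 : |H * (Ai * Aj)| ≤ 8 * (M * n * D ^ 2) := by
      calc |H * (Ai * Aj)| ≤ (2 * M * (n * D)) * ((2 * r) * (2 * r)) := by
            rw [abs_mul, abs_mul]; gcongr
        _ = 8 * (M * n * D ^ 2) := by rw [← hr]; ring
    have h3 := (mul_le_mul_of_nonneg_left h1 (abs_nonneg (derivWithin φ (Set.Ici 0) D)))
    have h4 := (mul_le_mul_of_nonneg_left h2 (abs_nonneg (deriv (deriv φ) D)))
    rw [← abs_mul] at h3 h4
    rw [abs_mul, abs_of_nonneg (sq_nonneg D)] at hχ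
    have h5 := mul_le_mul_of_nonneg_left hψ (mul_nonneg hM hn)
    have h6 := mul_le_mul_of_nonneg_left hχ (mul_nonneg hM hn)
    have h7 := neg_abs_le (derivWithin φ (Set.Ici 0) D * (gi * Aj + gj * Ai + H * Aij))
    have h8 := neg_abs_le (deriv (deriv φ) D * (H * (Ai * Aj)))
    have h9 : 0 ≤ M * n * α := by positivity
    linarith
  · have hxs := symmetrize_mem_unitCube G hx
    have hD := symD_nonneg G x
    have hφx := hφ01 _ hD
    have hψ := abs_mul_derivWithin_Ici_le (by positivity) hφ' hD
    rw [fderiv_pert_apply hinv hφC1]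
    have hmono := mul_nonneg (sub_nonneg.2 hφx.2) (hF1 x hx i)
    have hmonoS := mul_nonneg hφx.1 (hF1 _ hxs i)
    have hH := (abs_mExt_sub_mExt_symmetrize_le hinv hM hfM hx).trans (key x)
    have hA := abs_asymForm_single_le G (abs_asymCLM_apply_le_one G hx) i
    generalize symD G x = D at *
    generalize (Fintype.card X : ℝ) = n at *
    generalize mExt f x - mExt f (symmetrize G x) = H at *
    generalize asymForm G x (Pi.single i 1) = A at *
    have h1 : |H * A| ≤ (2 * M * (n * D)) * (2 * 1) := by
      rw [abs_mul]; gcongr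
    have h2 := mul_le_mul_of_nonneg_left h1 (abs_nonneg (derivWithin φ (Set.Ici 0) D))
    rw [← abs_mul] at h2
    have h3 := mul_le_mul_of_nonneg_left hψ (mul_nonneg hM hn)
    have h4 := le_abs_self (derivWithin φ (Set.Ici 0) D * (H * A))
    have h5 : 0 ≤ M * n * α := by positivity
    linarith
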